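/- arXiv:math-ph/0602039 — 2 statements merged into one kernel-verified Lean document; each statement's English description precedes it below -/
import Mathlib

section
/- Let N ≥ 1, n ≥ 1, and μ_1,…,μ_n ∈ ℂ, and set M = diag(μ_1,…,μ_n). Let γ_GUE^{(N)} be the probability measure on N×N complex Hermitian matrices with density proportional to exp(−(N/2)·Tr H²), and let γ^{(n,N)} be the probability measure on n×n complex Hermitian matrices q with density proportional to exp(−(N/2)·Tr q²) (note: the same parameter N, not n, in the exponent). Then the n-point correlation function of permanental polynomials satisfies ∫ ∏_{k=1}^n Per(μ_k·1_N − H) dγ_GUE^{(N)}(H) = ∫ [ Per(M − q) ]^N dγ^{(n,N)}(q). -/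
open MeasureTheory Matrix Finset Polynomial

instance matMS {m n : Type*} {α : Type*} [MeasurableSpace α] : MeasurableSpace (Matrix m n α) :=
  inferInstanceAs (MeasurableSpace (m → n → α))

/-- The permanent of a square complex matrix. -/
noncomputable def perm {ι : Type*} [Fintype ι] [DecidableEq ι] (M : Matrix ι ι ℂ) : ℂ :=
  ∑ σ : Equiv.Perm ι, ∏ i, M i (σ i)

/-- The Hermitian matrix built from the coordinates: diagonal entries `x.1 i`, and for
`i < j` the entry `H_ij = (Re H_ij) + i (Im H_ij)` given by the pair `x.2 ⟨(i,j), _⟩`. -/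
noncomputable def hermOf (m : ℕ)
    (x : (Fin m → ℝ) × ({p : Fin m × Fin m // p.1 < p.2} → ℝ × ℝ)) :
    Matrix (Fin m) (Fin m) ℂ := fun i j =>
  if h : i < j then ((x.2 ⟨(i, j), h⟩).1 : ℂ) + ((x.2 ⟨(i, j), h⟩).2 : ℂ) * Complex.I
  else if h' : j < i then ((x.2 ⟨(j, i), h'⟩).1 : ℂ) - ((x.2 ⟨(j, i), h'⟩).2 : ℂ) * Complex.I
  else ((x.1 i : ℝ) : ℂ)

/-- The Gaussian probability measure on `m × m` complex Hermitian matrices with density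
`2^{-m/2} (N/π)^{m²/2} exp(-(N/2) Tr H²)` with respect to Lebesgue measure in the
coordinates `(H_ii)_i, (Re H_ij, Im H_ij)_{i<j}`.  For `m = N` this is the GUE measure. -/
noncomputable def gaussHerm (N m : ℕ) : Measure (Matrix (Fin m) (Fin m) ℂ) :=
  Measure.map (hermOf m) (volume.withDensity fun x =>
    ENNReal.ofReal ((2 : ℝ) ^ (-(m : ℝ) / 2) * ((N : ℝ) / Real.pi) ^ ((m : ℝ) ^ 2 / 2) *
      Real.exp (-(N : ℝ) / 2 * (Matrix.trace (hermOf m x ^ 2)).re)))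

/-! ### The coordinates on Hermitian matrices -/

/-- The real coordinate space of the `m × m` Hermitian matrices. -/
abbrev HermCoord (m : ℕ) : Type :=
  (Fin m → ℝ) × ({p : Fin m × Fin m // p.1 < p.2} → ℝ × ℝ)

lemma hermOf_add_smul {m : ℕ} (x v : HermCoord m) (t : ℝ) :
    hermOf m (x + t • v) = hermOf m x + (t : ℂ) • hermOf m v := by
  ext i j
  simp only [hermOf, Matrix.add_apply, Matrix.smul_apply]
  split_ifs <;> simp <;> ring

lemma isHermitian_hermOf {m : ℕ} (x : HermCoord m) : (hermOf m x).IsHermitian := by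
  ext i j
  simp only [Matrix.conjTranspose_apply, hermOf]
  rcases lt_trichotomy i j with h | h | h
  · simp [h, h.not_gt, sub_eq_add_neg]
  · simp [h]
  · simp [h, h.not_gt, sub_eq_add_neg]

lemma exists_hermOf_eq {m : ℕ} {A : Matrix (Fin m) (Fin m) ℂ} (hA : A.IsHermitian) :
    ∃ v, hermOf m v = A := by
  refine ⟨(fun i => (A i i).re, fun p => ((A p.1.1 p.1.2).re, (A p.1.1 p.1.2).im)), ?_⟩
  ext i j
  simp only [hermOf]
  rcases lt_trichotomy i j with h | h | h
  · simp [h, Complex.re_add_im]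
  · subst h
    simpa using hA.coe_re_apply_self i
  · rw [← hA.apply i j]
    apply Complex.ext <;> simp [h, h.not_gt]

/-- Every complex matrix is a complex combination of two Hermitian ones. -/
lemma exists_hermOf_add_I_smul {m : ℕ} (W : Matrix (Fin m) (Fin m) ℂ) :
    ∃ u v, hermOf m u + Complex.I • hermOf m v = W := by
  obtain ⟨u, hu⟩ := exists_hermOf_eq (A := (realPart W : Matrix (Fin m) (Fin m) ℂ))
    (realPart W).2
  obtain ⟨v, hv⟩ := exists_hermOf_eq (A := (imaginaryPart W : Matrix (Fin m) (Fin m) ℂ))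
    (imaginaryPart W).2
  exact ⟨u, v, by rw [hu, hv, realPart_add_I_smul_imaginaryPart]⟩

lemma trace_hermOf_mul_eq_re {m : ℕ} (x v : HermCoord m) :
    (hermOf m x * hermOf m v).trace = ((hermOf m x * hermOf m v).trace.re : ℂ) := by
  refine (Complex.conj_eq_iff_re.mp ?_).symm
  rw [starRingEnd_apply, ← Matrix.trace_conjTranspose, Matrix.conjTranspose_mul,
    (isHermitian_hermOf x).eq, (isHermitian_hermOf v).eq, Matrix.trace_mul_comm]

lemma sum_sum_eq_sum_diag_add_sum_lt {R : Type*} [AddCommMonoid R] {m : ℕ}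
    (f : Fin m → Fin m → R) :
    ∑ i, ∑ j, f i j =
      ∑ i, f i i + ∑ p : {p : Fin m × Fin m // p.1 < p.2}, (f p.1.1 p.1.2 + f p.1.2 p.1.1) := by
  have hsum : ∀ g : Fin m → Fin m → R, ∑ p : {p : Fin m × Fin m // p.1 < p.2}, g p.1.1 p.1.2 =
      ∑ i, ∑ j, if i < j then g i j else 0 := by
    intro g
    rw [← Fintype.sum_prod_type' (f := fun i j => if i < j then g i j else 0),
      ← Finset.sum_filter, ← Finset.sum_subtype_eq_sum_filter]
    simp [Finset.subtype_univ]
  rw [Finset.sum_add_distrib, hsum f, hsum fun i j => f j i,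
    Finset.sum_comm (f := fun i j => if i < j then f j i else 0),
    ← Finset.sum_add_distrib, ← Finset.sum_add_distrib]
  refine Finset.sum_congr rfl fun i _ => ?_
  have hdiag : f i i = ∑ j, if i = j then f i j else 0 := by simp
  rw [hdiag, ← Finset.sum_add_distrib, ← Finset.sum_add_distrib]
  refine Finset.sum_congr rfl fun j _ => ?_
  rcases lt_trichotomy i j with h | h | h
  · simp [h, h.ne, h.not_gt]
  · simp [h]
  · simp [h, h.ne', h.not_gt]

lemma card_lt_mul_two_add (m : ℕ) :
    m + Fintype.card {p : Fin m × Fin m // p.1 < p.2} * 2 = m * m := by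
  simpa using (sum_sum_eq_sum_diag_add_sum_lt (m := m) fun _ _ => (1 : ℕ)).symm

lemma trace_hermOf_sq_re {m : ℕ} (x : HermCoord m) :
    (hermOf m x ^ 2).trace.re =
      ∑ i, x.1 i ^ 2 + ∑ p, 2 * ((x.2 p).1 ^ 2 + (x.2 p).2 ^ 2) := by
  simp only [pow_two, Matrix.trace, Matrix.diag, Matrix.mul_apply]
  rw [sum_sum_eq_sum_diag_add_sum_lt]
  simp only [Complex.add_re, Complex.re_sum]
  congr 1
  · refine Finset.sum_congr rfl fun i _ => ?_
    simp [hermOf]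
  · refine Finset.sum_congr rfl fun p _ => ?_
    simp [hermOf, p.2, p.2.not_gt]
    ring

lemma norm_sq_le_trace_hermOf_sq_re {m : ℕ} (x : HermCoord m) :
    ‖x‖ ^ 2 ≤ (hermOf m x ^ 2).trace.re := by
  rw [trace_hermOf_sq_re]
  have h1 : 0 ≤ ∑ i, x.1 i ^ 2 := by positivity
  have h2 : 0 ≤ ∑ p, 2 * ((x.2 p).1 ^ 2 + (x.2 p).2 ^ 2) := by positivity
  have hle : ‖x‖ ≤ √(∑ i, x.1 i ^ 2 + ∑ p, 2 * ((x.2 p).1 ^ 2 + (x.2 p).2 ^ 2)) := by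
    refine norm_prod_le_iff.mpr ⟨(pi_norm_le_iff_of_nonneg (by positivity)).mpr fun i => ?_,
      (pi_norm_le_iff_of_nonneg (by positivity)).mpr fun p => norm_prod_le_iff.mpr ⟨?_, ?_⟩⟩
    · have := Finset.single_le_sum (f := fun i => x.1 i ^ 2) (fun _ _ => sq_nonneg _)
        (Finset.mem_univ i)
      exact Real.abs_le_sqrt (by linarith)
    all_goals
      have := Finset.single_le_sum (f := fun p => 2 * ((x.2 p).1 ^ 2 + (x.2 p).2 ^ 2))
        (fun _ _ => by positivity) (Finset.mem_univ p)
      exact Real.abs_le_sqrt (by nlinarith [sq_nonneg (x.2 p).1, sq_nonneg (x.2 p).2])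
  calc ‖x‖ ^ 2 ≤ _ := by gcongr
    _ = _ := Real.sq_sqrt (by positivity)

instance isAddHaarMeasure_volume_hermCoord (m : ℕ) :
    (volume : Measure (HermCoord m)).IsAddHaarMeasure :=
  Measure.prod.instIsAddHaarMeasure (volume : Measure (Fin m → ℝ))
    (volume : Measure ({p : Fin m × Fin m // p.1 < p.2} → ℝ × ℝ))

/-! ### The Gaussian weight -/

/-- The unnormalized Gaussian density in the coordinates of `hermOf`. -/
noncomputable def hermWeight (N m : ℕ) (x : HermCoord m) : ℝ :=
  Real.exp (-(N : ℝ) / 2 * (hermOf m x ^ 2).trace.re)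

lemma continuous_hermWeight (N m : ℕ) : Continuous (hermWeight N m) := by
  unfold hermWeight
  simp only [trace_hermOf_sq_re]
  fun_prop

lemma one_add_pow_mul_exp_neg_le {c : ℝ} (hc : 0 < c) (k : ℕ) {t : ℝ} (ht : 0 ≤ t) :
    (1 + t) ^ k * Real.exp (-(c * t ^ 2)) ≤ k.factorial * Real.exp (1 + 1 / (4 * c)) := by
  have h1 : (1 + t) ^ k ≤ k.factorial * Real.exp (1 + t) := by
    have := Real.pow_div_factorial_le_exp (1 + t) (by positivity) k
    rwa [div_le_iff₀' (by positivity)] at this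
  have h2 : t - c * t ^ 2 ≤ 1 / (4 * c) := by
    rw [le_div_iff₀ (by positivity)]
    nlinarith [sq_nonneg (2 * c * t - 1)]
  calc (1 + t) ^ k * Real.exp (-(c * t ^ 2))
      ≤ k.factorial * Real.exp (1 + t) * Real.exp (-(c * t ^ 2)) := by gcongr
    _ = k.factorial * Real.exp (1 + t - c * t ^ 2) := by
        rw [mul_assoc, ← Real.exp_add, sub_eq_add_neg]
    _ ≤ _ := by gcongr; linarith

lemma integrable_mul_hermWeight {N m : ℕ} (hN : 1 ≤ N) {f : HermCoord m → ℂ}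
    (hf : f.HasTemperateGrowth) : Integrable fun x => f x * (hermWeight N m x : ℂ) := by
  obtain ⟨k, C, hC, hle⟩ := hf.norm_iteratedFDeriv_le_uniform 0
  have hle' : ∀ x, ‖f x‖ ≤ C * (1 + ‖x‖) ^ k := fun x => by simpa using hle 0 le_rfl x
  set d := Module.finrank ℝ (HermCoord m) + 1
  have hd : (Module.finrank ℝ (HermCoord m) : ℝ) < (d : ℕ) := by simp [d]
  have hN' : (0 : ℝ) < (N : ℝ) / 2 := by
    have : (0 : ℝ) < N := by exact_mod_cast hN
    positivity
  set K := ((k + d).factorial : ℝ) * Real.exp (1 + 1 / (4 * ((N : ℝ) / 2)))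
  refine ((integrable_one_add_norm (μ := (volume : Measure (HermCoord m))) hd).const_mul
    (C * K)).mono' ?_ (Filter.Eventually.of_forall fun x => ?_)
  · exact (hf.1.continuous.mul
      (Complex.continuous_ofReal.comp (continuous_hermWeight N m))).aestronglyMeasurable
  · have hpos : 0 < 1 + ‖x‖ := by positivity
    have hpos' : 0 ≤ hermWeight N m x := (Real.exp_pos _).le
    have hw : hermWeight N m x ≤ Real.exp (-((N : ℝ) / 2 * ‖x‖ ^ 2)) := by
      unfold hermWeight
      gcongr
      nlinarith [norm_sq_le_trace_hermOf_sq_re x]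
    have hK := one_add_pow_mul_exp_neg_le hN' (k + d) (norm_nonneg x)
    rw [norm_mul, Complex.norm_real, Real.norm_of_nonneg hpos', Real.rpow_neg hpos.le,
      Real.rpow_natCast, ← div_eq_mul_inv, le_div_iff₀ (by positivity)]
    calc ‖f x‖ * hermWeight N m x * (1 + ‖x‖) ^ d
        ≤ C * (1 + ‖x‖) ^ k * Real.exp (-((N : ℝ) / 2 * ‖x‖ ^ 2)) * (1 + ‖x‖) ^ d := by
          gcongr
          exact hle' x
      _ = C * ((1 + ‖x‖) ^ (k + d) * Real.exp (-((N : ℝ) / 2 * ‖x‖ ^ 2))) := by ring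
      _ ≤ C * K := by gcongr

/-! ### Gaussian integration by parts -/

/-- The affine function `c + Tr (H W)` of the Hermitian matrix `H` with coordinates `x`. -/
noncomputable def hermAffine {m : ℕ} (c : ℂ) (W : Matrix (Fin m) (Fin m) ℂ) (x : HermCoord m) :
    ℂ :=
  c + (hermOf m x * W).trace

lemma hermAffine_add_smul {m : ℕ} (c : ℂ) (W : Matrix (Fin m) (Fin m) ℂ) (x v : HermCoord m)
    (t : ℝ) :
    hermAffine c W (x + t • v) = hermAffine c W x + t * (hermOf m v * W).trace := by
  simp [hermAffine, hermOf_add_smul, Matrix.add_mul, add_assoc]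

lemma hasTemperateGrowth_hermAffine {m : ℕ} (c : ℂ) (W : Matrix (Fin m) (Fin m) ℂ) :
    (hermAffine c W).HasTemperateGrowth := by
  let L : HermCoord m →ₗ[ℝ] ℂ :=
    { toFun := hermAffine 0 W
      map_add' := fun x y => by
        have := hermAffine_add_smul 0 W x y 1
        simpa [hermAffine] using this
      map_smul' := fun t x => by
        have h0 := hermAffine_add_smul 0 W 0 x t
        have h1 := hermAffine_add_smul 0 W 0 0 1
        simp [hermAffine] at h0 h1
        simp [hermAffine, h0, h1] }
  have h : hermAffine c W = fun x => c + L.toContinuousLinearMap x := by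
    ext x
    simp [L, hermAffine]
  rw [h]
  exact (Function.HasTemperateGrowth.const c).add L.toContinuousLinearMap.hasTemperateGrowth

lemma hasTemperateGrowth_prod {E ι : Type*} [NormedAddCommGroup E] [NormedSpace ℝ E]
    (S : Finset ι) {f : ι → E → ℂ} (hf : ∀ r ∈ S, (f r).HasTemperateGrowth) :
    (fun x => ∏ r ∈ S, f r x).HasTemperateGrowth := by
  classical
  induction S using Finset.induction_on with
  | empty => simp
  | insert a S ha ih =>
    simp only [Finset.prod_insert ha]
    exact (hf a (by simp)).mul (ih fun r hr => hf r (by simp [hr]))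

lemma hasLineDerivAt_hermWeight (N m : ℕ) (x v : HermCoord m) :
    HasLineDerivAt ℝ (fun x => (hermWeight N m x : ℂ))
      (-(N * (hermOf m x * hermOf m v).trace) * hermWeight N m x) x v := by
  rw [trace_hermOf_mul_eq_re]
  have hexp : ∀ t : ℝ, (hermOf m (x + t • v) ^ 2).trace.re = (hermOf m x ^ 2).trace.re +
      2 * t * (hermOf m x * hermOf m v).trace.re + t ^ 2 * (hermOf m v ^ 2).trace.re := by
    intro t
    rw [hermOf_add_smul]
    simp only [pow_two, Matrix.add_mul, Matrix.mul_add, Matrix.smul_mul, Matrix.mul_smul,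
      Matrix.trace_add, Matrix.trace_smul, Matrix.trace_mul_comm (hermOf m v) (hermOf m x)]
    simp
    ring
  have hpoly : HasDerivAt (fun t : ℝ => -(N : ℝ) / 2 * ((hermOf m x ^ 2).trace.re +
      2 * t * (hermOf m x * hermOf m v).trace.re + t ^ 2 * (hermOf m v ^ 2).trace.re))
      (-(N : ℝ) * (hermOf m x * hermOf m v).trace.re) 0 := by
    have h1 : HasDerivAt (fun t : ℝ => t) 1 0 := hasDerivAt_id 0
    refine HasDerivAt.congr_deriv (((((h1.const_mul 2).mul_const (hermOf m x * hermOf m v).trace.re).const_add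
      (hermOf m x ^ 2).trace.re).add ((h1.pow 2).mul_const
        (hermOf m v ^ 2).trace.re)).const_mul (-(N : ℝ) / 2)) ?_
    simp
    ring
  have hreal : HasDerivAt (fun t : ℝ => hermWeight N m (x + t • v))
      (-(N : ℝ) * (hermOf m x * hermOf m v).trace.re * hermWeight N m x) 0 := by
    unfold hermWeight
    simp only [hexp]
    convert hpoly.exp using 1
    simp
    ring
  have := hreal.ofReal_comp
  unfold HasLineDerivAt
  refine this.congr_deriv ?_
  push_cast
  ring

section Stein

variable {ι : Type*}

/-- The unnormalized Gaussian integral of a product of affine functions. -/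
noncomputable def hermMoment (N : ℕ) {m : ℕ} (c : ι → ℂ) (W : ι → Matrix (Fin m) (Fin m) ℂ)
    (S : Finset ι) : ℂ :=
  ∫ x, (∏ r ∈ S, hermAffine (c r) (W r) x) * (hermWeight N m x : ℂ)

lemma integrable_prod_hermAffine {N m : ℕ} (hN : 1 ≤ N) (c : ι → ℂ)
    (W : ι → Matrix (Fin m) (Fin m) ℂ) (S : Finset ι) :
    Integrable fun x => (∏ r ∈ S, hermAffine (c r) (W r) x) * (hermWeight N m x : ℂ) :=
  integrable_mul_hermWeight hN
    (hasTemperateGrowth_prod S fun r _ => hasTemperateGrowth_hermAffine (c r) (W r))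

lemma integrable_trace_mul_prod_hermAffine {N m : ℕ} (hN : 1 ≤ N) (c : ι → ℂ)
    (W : ι → Matrix (Fin m) (Fin m) ℂ) (S : Finset ι) (V : Matrix (Fin m) (Fin m) ℂ) :
    Integrable fun x => (hermOf m x * V).trace *
      (∏ r ∈ S, hermAffine (c r) (W r) x) * (hermWeight N m x : ℂ) := by
  have hV : (fun x => (hermOf m x * V).trace).HasTemperateGrowth := by
    have h : (fun x => (hermOf m x * V).trace) = hermAffine 0 V := by
      ext x
      simp [hermAffine]
    exact h ▸ hasTemperateGrowth_hermAffine 0 V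
  exact integrable_mul_hermWeight hN (hV.mul
    (hasTemperateGrowth_prod S fun r _ => hasTemperateGrowth_hermAffine (c r) (W r)))

lemma hasLineDerivAt_prod_hermAffine [DecidableEq ι] {m : ℕ} (c : ι → ℂ) (W : ι → Matrix (Fin m) (Fin m) ℂ)
    (S : Finset ι) (x v : HermCoord m) :
    HasLineDerivAt ℝ (fun x => ∏ r ∈ S, hermAffine (c r) (W r) x)
      (∑ r ∈ S, (hermOf m v * W r).trace * ∏ s ∈ S.erase r, hermAffine (c s) (W s) x) x v := by
  unfold HasLineDerivAt
  have h : ∀ r ∈ S, HasDerivAt (fun t : ℝ => hermAffine (c r) (W r) (x + t • v))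
      (hermOf m v * W r).trace 0 := by
    intro r _
    simp only [hermAffine_add_smul]
    simpa using ((hasDerivAt_id (0 : ℝ)).ofReal_comp.mul_const
      (hermOf m v * W r).trace).const_add (hermAffine (c r) (W r) x)
  refine (HasDerivAt.fun_finsetProd h).congr_deriv ?_
  simp [mul_comm]

lemma integral_trace_hermOf_mul_prod [DecidableEq ι] {N m : ℕ} (hN : 1 ≤ N) (c : ι → ℂ)
    (W : ι → Matrix (Fin m) (Fin m) ℂ) (S : Finset ι) (v : HermCoord m) :
    N * ∫ x, (hermOf m x * hermOf m v).trace * (∏ r ∈ S, hermAffine (c r) (W r) x) *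
        (hermWeight N m x : ℂ) =
      ∑ r ∈ S, (hermOf m v * W r).trace * hermMoment N c W (S.erase r) := by
  have hint : ∀ r ∈ S, Integrable fun x => (hermOf m v * W r).trace *
      ((∏ s ∈ S.erase r, hermAffine (c s) (W s) x) * (hermWeight N m x : ℂ)) := fun r _ =>
    (integrable_prod_hermAffine hN c W _).const_mul _
  have hparts := integral_bilinear_hasLineDerivAt_right_eq_neg_left_of_integrable
    (μ := (volume : Measure (HermCoord m))) (B := ContinuousLinearMap.mul ℝ ℂ)
    (f := fun x => ∏ r ∈ S, hermAffine (c r) (W r) x)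
    (f' := fun x => ∑ r ∈ S, (hermOf m v * W r).trace *
      ∏ s ∈ S.erase r, hermAffine (c s) (W s) x)
    (g := fun x => (hermWeight N m x : ℂ))
    (g' := fun x => -(N * (hermOf m x * hermOf m v).trace) * hermWeight N m x) (v := v)
    (by
      simp only [ContinuousLinearMap.mul_apply', Finset.sum_mul, mul_assoc]
      exact integrable_finsetSum _ hint)
    (by
      convert (integrable_trace_mul_prod_hermAffine hN c W S (hermOf m v)).const_mul (-(N : ℂ))
        using 2 with x
      simp only [ContinuousLinearMap.mul_apply']
      ring)
    (by simpa using integrable_prod_hermAffine hN c W S)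
    (fun x _ => hasLineDerivAt_prod_hermAffine c W S x v)
    (fun x _ => hasLineDerivAt_hermWeight N m x v)
  simp only [ContinuousLinearMap.mul_apply'] at hparts
  rw [← integral_const_mul]
  calc ∫ x, (N : ℂ) * ((hermOf m x * hermOf m v).trace *
        (∏ r ∈ S, hermAffine (c r) (W r) x) * (hermWeight N m x : ℂ))
      = -∫ x, (∏ r ∈ S, hermAffine (c r) (W r) x) *
          (-(N * (hermOf m x * hermOf m v).trace) * hermWeight N m x) := by
        rw [← integral_neg]
        congr 1 with x
        ring
    _ = ∑ r ∈ S, (hermOf m v * W r).trace * hermMoment N c W (S.erase r) := by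
        rw [hparts, neg_neg]
        simp only [Finset.sum_mul, mul_assoc]
        rw [integral_finsetSum _ hint]
        simp only [integral_const_mul, hermMoment]

lemma integral_trace_mul_prod [DecidableEq ι] {N m : ℕ} (hN : 1 ≤ N) (c : ι → ℂ)
    (W : ι → Matrix (Fin m) (Fin m) ℂ) (S : Finset ι) (V : Matrix (Fin m) (Fin m) ℂ) :
    N * ∫ x, (hermOf m x * V).trace * (∏ r ∈ S, hermAffine (c r) (W r) x) *
        (hermWeight N m x : ℂ) =
      ∑ r ∈ S, (V * W r).trace * hermMoment N c W (S.erase r) := by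
  obtain ⟨u, v, rfl⟩ := exists_hermOf_add_I_smul V
  have hu := integral_trace_hermOf_mul_prod hN c W S u
  have hv := integral_trace_hermOf_mul_prod hN c W S v
  simp only [Matrix.mul_add, Matrix.mul_smul, Matrix.smul_mul, Matrix.trace_add,
    Matrix.trace_smul, smul_eq_mul, add_mul, Finset.sum_add_distrib, mul_assoc Complex.I,
    ← Finset.mul_sum]
  rw [integral_add (integrable_trace_mul_prod_hermAffine hN c W S _)
    ((integrable_trace_mul_prod_hermAffine hN c W S _).const_mul _), integral_const_mul, ← hu, ← hv]
  ring

lemma hermMoment_insert [DecidableEq ι] {N m : ℕ} (hN : 1 ≤ N) (c : ι → ℂ)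
    (W : ι → Matrix (Fin m) (Fin m) ℂ) {S : Finset ι} {a : ι} (ha : a ∉ S) :
    hermMoment N c W (insert a S) = c a * hermMoment N c W S +
      (N : ℂ)⁻¹ * ∑ r ∈ S, (W a * W r).trace * hermMoment N c W (S.erase r) := by
  have hN' : (N : ℂ) ≠ 0 := by exact_mod_cast Nat.one_le_iff_ne_zero.mp hN
  rw [← integral_trace_mul_prod hN, inv_mul_cancel_left₀ hN', hermMoment, hermMoment,
    ← integral_const_mul, ← integral_add ((integrable_prod_hermAffine hN c W S).const_mul _)
      (integrable_trace_mul_prod_hermAffine hN c W S _)]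
  congr 1 with x
  rw [Finset.prod_insert ha]
  simp only [hermAffine]
  ring

/-- Gaussian moments of affine functions of a Hermitian matrix, divided by the total mass, depend
on the linear parts only through their Gram matrix for the trace pairing. -/
lemma hermMoment_mul_eq_of_trace_eq [DecidableEq ι] {N m m' : ℕ} (hN : 1 ≤ N) (c : ι → ℂ)
    (W : ι → Matrix (Fin m) (Fin m) ℂ) (W' : ι → Matrix (Fin m') (Fin m') ℂ)
    (hW : ∀ r s, (W r * W s).trace = (W' r * W' s).trace) {z z' : ℂ}
    (hz : z * hermMoment N c W ∅ = z' * hermMoment N c W' ∅) (S : Finset ι) :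
    z * hermMoment N c W S = z' * hermMoment N c W' S := by
  induction S using Finset.strongInduction with
  | H S ih =>
    rcases S.eq_empty_or_nonempty with rfl | ⟨a, ha⟩
    · exact hz
    · rw [← Finset.insert_erase ha, hermMoment_insert hN c W (S.notMem_erase a),
        hermMoment_insert hN c W' (S.notMem_erase a), mul_add, mul_add, mul_left_comm,
        ih _ (Finset.erase_ssubset ha), mul_left_comm z', mul_left_comm z, mul_left_comm z']
      congr 2
      rw [Finset.mul_sum, Finset.mul_sum]
      refine Finset.sum_congr rfl fun r hr => ?_
      rw [mul_left_comm, ih _ ((Finset.erase_ssubset hr).trans (Finset.erase_ssubset ha)), hW,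
        mul_left_comm]

end Stein

/-! ### Normalization and integration against the Gaussian measure -/

/-- The normalizing constant of `gaussHerm N m`. -/
noncomputable def gaussHermConst (N m : ℕ) : ℝ :=
  (2 : ℝ) ^ (-(m : ℝ) / 2) * ((N : ℝ) / Real.pi) ^ ((m : ℝ) ^ 2 / 2)

lemma integral_hermWeight (N m : ℕ) :
    ∫ x, hermWeight N m x = √(Real.pi / (N / 2)) ^ m *
      (√(Real.pi / N) * √(Real.pi / N)) ^ Fintype.card {p : Fin m × Fin m // p.1 < p.2} := by
  have hfactor : ∀ x : HermCoord m, hermWeight N m x =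
      (∏ i, Real.exp (-(N / 2 : ℝ) * x.1 i ^ 2)) *
        ∏ p, Real.exp (-(N : ℝ) * (x.2 p).1 ^ 2) * Real.exp (-(N : ℝ) * (x.2 p).2 ^ 2) := by
    intro x
    simp only [hermWeight, trace_hermOf_sq_re, ← Real.exp_add, ← Real.exp_sum, ← Finset.mul_sum,
      ← mul_add]
    congr 1
    ring
  simp only [hfactor]
  rw [Measure.volume_eq_prod, integral_prod_mul
    (fun u : Fin m → ℝ => ∏ i, Real.exp (-(N / 2 : ℝ) * u i ^ 2))
    (fun w : {p : Fin m × Fin m // p.1 < p.2} → ℝ × ℝ =>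
      ∏ p, Real.exp (-(N : ℝ) * (w p).1 ^ 2) * Real.exp (-(N : ℝ) * (w p).2 ^ 2)),
    integral_fintype_prod_volume_eq_pow fun u : ℝ => Real.exp (-(N / 2 : ℝ) * u ^ 2),
    integral_fintype_prod_volume_eq_pow fun w : ℝ × ℝ =>
      Real.exp (-(N : ℝ) * w.1 ^ 2) * Real.exp (-(N : ℝ) * w.2 ^ 2),
    Measure.volume_eq_prod, integral_prod_mul (fun u : ℝ => Real.exp (-(N : ℝ) * u ^ 2))
      fun u : ℝ => Real.exp (-(N : ℝ) * u ^ 2), integral_gaussian, integral_gaussian,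
    Fintype.card_fin]

lemma gaussHermConst_mul_integral_hermWeight {N : ℕ} (hN : 1 ≤ N) (m : ℕ) :
    gaussHermConst N m * ∫ x, hermWeight N m x = 1 := by
  have hN' : (0 : ℝ) < N := by exact_mod_cast hN
  have hπ := Real.pi_pos
  have ht : 0 < √((N : ℝ) / Real.pi) := by positivity
  have h2 : (0 : ℝ) < √2 := by positivity
  have hs1 : √(Real.pi / (N / 2)) = √2 / √((N : ℝ) / Real.pi) := by
    rw [← Real.sqrt_div' _ (by positivity)]
    congr 1
    field_simp
  have hs2 : √(Real.pi / N) = (√((N : ℝ) / Real.pi))⁻¹ := by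
    rw [← Real.sqrt_inv, inv_div]
  have hc1 : (2 : ℝ) ^ (-(m : ℝ) / 2) = (√2 ^ m)⁻¹ := by
    rw [Real.sqrt_eq_rpow, ← Real.rpow_natCast, ← Real.rpow_mul (by norm_num),
      ← Real.rpow_neg (by norm_num)]
    congr 1
    ring
  have hc2 : ((N : ℝ) / Real.pi) ^ ((m : ℝ) ^ 2 / 2) = √((N : ℝ) / Real.pi) ^ (m * m) := by
    rw [Real.sqrt_eq_rpow, ← Real.rpow_natCast _ (m * m), ← Real.rpow_mul (by positivity)]
    congr 1
    push_cast
    ring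
  rw [integral_hermWeight, gaussHermConst, hc1, hc2, hs1, hs2, ← card_lt_mul_two_add m]
  generalize Fintype.card {p : Fin m × Fin m // p.1 < p.2} = k
  rw [div_pow, pow_add, pow_mul, mul_pow, inv_pow]
  field_simp

lemma measurable_hermOf (m : ℕ) : Measurable (hermOf m) := by
  refine measurable_pi_iff.mpr fun i => measurable_pi_iff.mpr fun j => ?_
  unfold hermOf
  split_ifs <;> fun_prop

lemma integral_gaussHerm (N m : ℕ) {f : Matrix (Fin m) (Fin m) ℂ → ℂ} (hf : Measurable f) :
    ∫ H, f H ∂gaussHerm N m =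
      gaussHermConst N m * ∫ x, f (hermOf m x) * (hermWeight N m x : ℂ) := by
  have hconst : 0 ≤ gaussHermConst N m := by unfold gaussHermConst; positivity
  have hmeas : Measurable fun x => ENNReal.ofReal (gaussHermConst N m * hermWeight N m x) :=
    ((continuous_hermWeight N m).measurable.const_mul _).ennreal_ofReal
  change ∫ H, f H ∂(Measure.map (hermOf m) (volume.withDensity fun x =>
    ENNReal.ofReal (gaussHermConst N m * hermWeight N m x))) = _
  rw [integral_map (measurable_hermOf m).aemeasurable hf.aestronglyMeasurable,
    integral_withDensity_eq_integral_toReal_smul hmeas (by simp), ← integral_const_mul]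
  congr 1 with x
  have hweight : 0 ≤ hermWeight N m x := (Real.exp_pos _).le
  rw [ENNReal.toReal_ofReal (mul_nonneg hconst hweight), Complex.real_smul]
  push_cast
  ring

lemma measurable_perm_sub {m : ℕ} (A : Matrix (Fin m) (Fin m) ℂ) :
    Measurable fun H : Matrix (Fin m) (Fin m) ℂ => perm (A - H) := by
  have hentry : ∀ i j, Measurable fun H : Matrix (Fin m) (Fin m) ℂ => H i j := fun i j =>
    (measurable_pi_apply j).comp (measurable_pi_apply i)
  simp only [perm, Matrix.sub_apply]
  fun_prop

/-! ### Polarization of permanents -/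

section Polarization

variable {ι : Type*} [Fintype ι] [DecidableEq ι]

lemma sum_units_prod_mul_comp (f : ι → ι) [Decidable f.Bijective] :
    ∑ y : ι → ℤˣ, (((∏ i, y i * y (f i) : ℤˣ) : ℤ) : ℂ) =
      if f.Bijective then 2 ^ Fintype.card ι else 0 := by
  split_ifs with hf
  · have h : ∀ y : ι → ℤˣ, ∏ i, y i * y (f i) = 1 := by
      intro y
      rw [Finset.prod_mul_distrib, hf.prod_comp y, Int.units_mul_self]
    simp [h]
  · obtain ⟨j, hj⟩ : ∃ j, ∀ i, f i ≠ j := by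
      have : ¬ f.Surjective := fun h => hf ⟨Finite.injective_iff_surjective.mpr h, h⟩
      simpa [Function.Surjective] using this
    have hflip : ∀ y : ι → ℤˣ,
        ∏ i, (Pi.mulSingle j (-1) * y : ι → ℤˣ) i * (Pi.mulSingle j (-1) * y : ι → ℤˣ) (f i) =
          -∏ i, y i * y (f i) := by
      intro y
      simp [Finset.prod_mul_distrib, Pi.mulSingle_eq_of_ne (hj _), mul_assoc]
    have hsum := Equiv.sum_comp (Equiv.mulLeft (Pi.mulSingle j (-1) : ι → ℤˣ))
      fun y : ι → ℤˣ => (((∏ i, y i * y (f i) : ℤˣ) : ℤ) : ℂ)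
    simp only [Equiv.coe_mulLeft, hflip, Units.val_neg, Int.cast_neg, Finset.sum_neg_distrib]
      at hsum
    exact CharZero.neg_eq_self_iff.mp hsum

lemma sum_perm_eq_sum_bijective (g : (ι → ι) → ℂ)
    [DecidablePred (Function.Bijective : (ι → ι) → Prop)] :
    ∑ σ : Equiv.Perm ι, g σ = ∑ f : ι → ι, if f.Bijective then g f else 0 := by
  rw [← Finset.sum_filter]
  refine Finset.sum_bij (fun σ _ => σ) (by simp)
    (fun _ _ _ _ h => DFunLike.coe_injective h) (fun f hf => ?_) (by simp)
  exact ⟨Equiv.ofBijective f (Finset.mem_filter.mp hf).2, by simp⟩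

/-- A permanent is the multilinear part of a product of linear forms, extracted by signs. -/
lemma two_pow_card_mul_perm (A : Matrix ι ι ℂ) :
    2 ^ Fintype.card ι * perm A =
      ∑ y : ι → ℤˣ, ∏ i, ((y i : ℤ) : ℂ) * ∑ j, A i j * ((y j : ℤ) : ℂ) := by
  classical
  have hexpand : ∀ y : ι → ℤˣ, ∏ i, ((y i : ℤ) : ℂ) * ∑ j, A i j * ((y j : ℤ) : ℂ) =
      ∑ f : ι → ι, (∏ i, A i (f i)) * (((∏ i, y i * y (f i) : ℤˣ) : ℤ) : ℂ) := by
    intro y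
    simp only [Finset.mul_sum]
    rw [Finset.prod_univ_sum, Fintype.piFinset_univ]
    refine Finset.sum_congr rfl fun f _ => ?_
    push_cast
    rw [← Finset.prod_mul_distrib]
    exact Finset.prod_congr rfl fun i _ => by ring
  simp only [hexpand]
  rw [Finset.sum_comm]
  simp only [← Finset.mul_sum, sum_units_prod_mul_comp]
  rw [perm, sum_perm_eq_sum_bijective fun f => ∏ i, A i (f i), Finset.mul_sum]
  exact Finset.sum_congr rfl fun f _ => by split_ifs <;> ring

lemma two_pow_mul_prod_perm {κ : Type*} [Fintype κ] [DecidableEq κ] (A : κ → Matrix ι ι ℂ) :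
    2 ^ (Fintype.card ι * Fintype.card κ) * ∏ k, perm (A k) =
      ∑ y : κ → ι → ℤˣ, (∏ k, ∏ i, ((y k i : ℤ) : ℂ)) *
        ∏ p : κ × ι, ∑ j, A p.1 p.2 j * ((y p.1 j : ℤ) : ℂ) := by
  have h : 2 ^ (Fintype.card ι * Fintype.card κ) * ∏ k, perm (A k) =
      ∏ k, 2 ^ Fintype.card ι * perm (A k) := by
    rw [Finset.prod_mul_distrib, Finset.prod_const, Finset.card_univ, pow_mul]
  simp only [h, two_pow_card_mul_perm]
  rw [Finset.prod_univ_sum, Fintype.piFinset_univ]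
  refine Finset.sum_congr rfl fun y _ => ?_
  simp only [Fintype.prod_prod_type, Finset.prod_mul_distrib]

end Polarization

/-! ### The duality -/

/-- The matrix `W` with `Tr (H W) = -∑ j, H i j * y j`. -/
noncomputable def rowForm {m : ℕ} (y : Fin m → ℤˣ) (i : Fin m) : Matrix (Fin m) (Fin m) ℂ :=
  -Matrix.vecMulVec (fun j => ((y j : ℤ) : ℂ)) (Pi.single i 1)

lemma trace_rowForm_mul_rowForm {m : ℕ} (y y' : Fin m → ℤˣ) (i i' : Fin m) :
    (rowForm y i * rowForm y' i').trace = ((y i' : ℤ) : ℂ) * ((y' i : ℤ) : ℂ) := by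
  simp [rowForm, Matrix.vecMulVec_mul_vecMulVec, Matrix.trace_vecMulVec, mul_comm]

lemma hermAffine_rowForm {m : ℕ} (d : Fin m → ℂ) (y : Fin m → ℤˣ) (i : Fin m) (x : HermCoord m) :
    hermAffine (d i * ((y i : ℤ) : ℂ)) (rowForm y i) x =
      ∑ j, (Matrix.diagonal d - hermOf m x) i j * ((y j : ℤ) : ℂ) := by
  simp [hermAffine, rowForm, Matrix.mul_vecMulVec, Matrix.trace_vecMulVec, Matrix.mulVec,
    dotProduct, Matrix.diagonal_apply, sub_eq_add_neg, Pi.single_apply, add_mul,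
    Finset.sum_add_distrib]

lemma two_pow_mul_integral_prod_perm {N : ℕ} (hN : 1 ≤ N) {m : ℕ} {κ : Type*} [Fintype κ]
    [DecidableEq κ] (d : κ → Fin m → ℂ) :
    2 ^ (m * Fintype.card κ) * ∫ H, ∏ k, perm (Matrix.diagonal (d k) - H) ∂gaussHerm N m =
      ∑ y : κ → Fin m → ℤˣ, (∏ k, ∏ i, ((y k i : ℤ) : ℂ)) * (gaussHermConst N m *
        hermMoment N (fun p : κ × Fin m => d p.1 p.2 * ((y p.1 p.2 : ℤ) : ℂ))
          (fun p => rowForm (y p.1) p.2) Finset.univ) := by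
  rw [integral_gaussHerm N m (Finset.measurable_fun_prod _ fun k _ => measurable_perm_sub _),
    mul_left_comm, ← integral_const_mul]
  have h : ∀ x, 2 ^ (m * Fintype.card κ) *
      ((∏ k, perm (Matrix.diagonal (d k) - hermOf m x)) * (hermWeight N m x : ℂ)) =
      ∑ y : κ → Fin m → ℤˣ, (∏ k, ∏ i, ((y k i : ℤ) : ℂ)) * ((∏ p : κ × Fin m,
        hermAffine (d p.1 p.2 * ((y p.1 p.2 : ℤ) : ℂ)) (rowForm (y p.1) p.2) x) *
          (hermWeight N m x : ℂ)) := by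
    intro x
    have := two_pow_mul_prod_perm fun k => Matrix.diagonal (d k) - hermOf m x
    rw [Fintype.card_fin] at this
    rw [← mul_assoc, this, Finset.sum_mul]
    simp only [hermAffine_rowForm, mul_assoc]
  simp only [h]
  rw [integral_finsetSum _ fun y _ => (integrable_prod_hermAffine hN _ _ _).const_mul _,
    Finset.mul_sum]
  refine Finset.sum_congr rfl fun y _ => ?_
  rw [integral_const_mul, mul_left_comm, hermMoment]

lemma gaussHermConst_mul_hermMoment_empty {N : ℕ} (hN : 1 ≤ N) {m : ℕ} {ι : Type*} (c : ι → ℂ)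
    (W : ι → Matrix (Fin m) (Fin m) ℂ) : gaussHermConst N m * hermMoment N c W ∅ = 1 := by
  simp only [hermMoment, Finset.prod_empty, one_mul]
  rw [integral_complex_ofReal, ← Complex.ofReal_mul, gaussHermConst_mul_integral_hermWeight hN,
    Complex.ofReal_one]

lemma hermMoment_univ_comp_equiv {N m : ℕ} {ι ι' : Type*} [Fintype ι] [Fintype ι'] (e : ι' ≃ ι)
    (c : ι → ℂ) (W : ι → Matrix (Fin m) (Fin m) ℂ) :
    hermMoment N (c ∘ e) (W ∘ e) Finset.univ = hermMoment N c W Finset.univ := by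
  simp only [hermMoment, Function.comp_apply]
  congr 1 with x
  rw [Equiv.prod_comp e fun r => hermAffine (c r) (W r) x]

/-- Duality for the `n`-point correlation function of GUE permanental polynomials:
`⟨∏_{k=1}^n Per(μ_k·1_N - H)⟩_{GUE(N)} = ∫ [Per(M - q)]^N dγ^{(n,N)}(q)`, where
`M = diag(μ_1,…,μ_n)` and `γ^{(n,N)}` is the Gaussian measure on `n × n` Hermitian
matrices with density proportional to `exp(-(N/2) Tr q²)`. -/
theorem gue_npoint_correlation_duality (N n : ℕ) (hN : 1 ≤ N) (hn : 1 ≤ n)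
    (μs : Fin n → ℂ) :
    (∫ H, (∏ k, perm (μs k • (1 : Matrix (Fin N) (Fin N) ℂ) - H)) ∂(gaussHerm N N))
      = ∫ q, (perm (Matrix.diagonal μs - q)) ^ N ∂(gaussHerm N n) := by
  have hsmul : ∀ k, μs k • (1 : Matrix (Fin N) (Fin N) ℂ) = Matrix.diagonal fun _ => μs k :=
    fun k => Matrix.smul_one_eq_diagonal (μs k)
  have hpow : ∀ q, perm (Matrix.diagonal μs - q) ^ N =
      ∏ _i : Fin N, perm (Matrix.diagonal μs - q) := by simp
  simp only [hsmul, hpow]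
  have hleft := two_pow_mul_integral_prod_perm hN fun (k : Fin n) (_ : Fin N) => μs k
  have hright := two_pow_mul_integral_prod_perm hN fun (_ : Fin N) => μs
  rw [Fintype.card_fin] at hleft hright
  refine mul_left_cancel₀ (pow_ne_zero (N * n) two_ne_zero) ?_
  rw [hleft, mul_comm N n, hright,
    ← Equiv.sum_comp (Equiv.piComm fun (_ : Fin n) (_ : Fin N) => ℤˣ)]
  refine Finset.sum_congr rfl fun y _ => ?_
  rw [← hermMoment_univ_comp_equiv (Equiv.prodComm (Fin n) (Fin N)), Finset.prod_comm]
  congr 1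
  refine hermMoment_mul_eq_of_trace_eq hN _ _ _ (fun r s => ?_) ?_ _
  · simp [trace_rowForm_mul_rowForm, mul_comm]
  · rw [gaussHermConst_mul_hermMoment_empty hN, gaussHermConst_mul_hermMoment_empty hN]
end

section
/- Let N ≥ 1 and let μ_N be the Haar probability measure on the unitary group U(N). Then for all a, b ∈ ℂ, the two-point correlation function of CUE permanental polynomials satisfies ∫_{U(N)} Per(a·1_N − U) · conj( Per(b·1_N − U) ) dμ_N(U) = N!·(N−1)! · Σ_{j=0}^N (a·b̄)^j / ( j! · (2N−1−j)! ). -/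
open MeasureTheory Matrix Finset

/-- The linear form attached to the `i`-th column of a matrix. -/
noncomputable def colForm {n : Type*} [Fintype n] (M : Matrix n n ℂ) (i : n) :
    MvPolynomial n ℂ :=
  ∑ j, MvPolynomial.C (M j i) * MvPolynomial.X j

/-- The product of the linear forms attached to the columns indexed by `S`. -/
noncomputable def colProd {n : Type*} [Fintype n] (S : Finset n) (M : Matrix n n ℂ) :
    MvPolynomial n ℂ :=
  ∏ i ∈ S, colForm M i

/-- The exponent vector of the squarefree monomial with support `S`. -/
noncomputable def indicatorExp {n : Type*} (S : Finset n) : n →₀ ℕ :=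
  ∑ i ∈ S, Finsupp.single i 1

/-- The product of the factorials of the entries of an exponent vector. -/
def factorialProd {n : Type*} [Fintype n] (α : n →₀ ℕ) : ℕ :=
  ∏ i, (α i).factorial

/-- The Fischer inner product `⟨P, Q⟩ = ∑ α, α! P_α conj Q_α`, linear in `P`. -/
noncomputable def fischer {n : Type*} [Fintype n] (Q : MvPolynomial n ℂ) :
    MvPolynomial n ℂ →ₗ[ℂ] ℂ :=
  (MvPolynomial.basisMonomials n ℂ).constr ℂ
    fun α => (factorialProd α : ℂ) * (starRingEnd ℂ) (Q.coeff α)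

section Fischer

open MvPolynomial

variable {n : Type*} [Fintype n]

omit [Fintype n] in
lemma indicatorExp_apply [DecidableEq n] (S : Finset n) (i : n) :
    indicatorExp S i = if i ∈ S then 1 else 0 := by
  simp [indicatorExp, Finsupp.finsetSum_apply, Finsupp.single_apply]

lemma factorialProd_indicatorExp (S : Finset n) : factorialProd (indicatorExp S) = 1 := by
  classical
  refine Finset.prod_eq_one fun i _ => ?_
  rw [indicatorExp_apply]
  split_ifs <;> rfl

lemma sum_indicatorExp (S : Finset n) : ∑ i, indicatorExp S i = S.card := by
  classical
  simp [indicatorExp_apply]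

lemma factorialProd_add_single (α : n →₀ ℕ) (j : n) :
    factorialProd (α + Finsupp.single j 1) = (α j + 1) * factorialProd α := by
  classical
  unfold factorialProd
  rw [← Finset.mul_prod_erase _ _ (Finset.mem_univ j),
    ← Finset.mul_prod_erase Finset.univ (fun i => (α i).factorial) (Finset.mem_univ j), ← mul_assoc]
  congr 1
  · simp [Nat.factorial_succ]
  · refine Finset.prod_congr rfl fun i hi => ?_
    simp [(Finset.ne_of_mem_erase hi)]

lemma fischer_monomial (Q : MvPolynomial n ℂ) (α : n →₀ ℕ) (c : ℂ) :
    fischer Q (monomial α c) = c * (factorialProd α * (starRingEnd ℂ) (Q.coeff α)) := by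
  have h : monomial α c = c • basisMonomials n ℂ α := by
    simp [smul_monomial]
  rw [h, map_smul, fischer, Module.Basis.constr_basis, smul_eq_mul]

lemma fischer_X_mul (Q P : MvPolynomial n ℂ) (j : n) :
    fischer Q (X j * P) = fischer (pderiv j Q) P := by
  induction P using MvPolynomial.induction_on' with
  | monomial α c =>
    have h : (X j * monomial α c : MvPolynomial n ℂ) = monomial (α + Finsupp.single j 1) c := by
      rw [X, monomial_mul, one_mul, add_comm]
    rw [h, fischer_monomial, fischer_monomial, coeff_pderiv, factorialProd_add_single]
    push_cast
    rw [map_mul, map_add, map_natCast, map_one]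
    ring
  | add p q hp hq => rw [mul_add, map_add, map_add, hp, hq]

lemma fischer_sum_C_mul (c : n → ℂ) (Q : n → MvPolynomial n ℂ) (P : MvPolynomial n ℂ) :
    fischer (∑ j, C (c j) * Q j) P = ∑ j, (starRingEnd ℂ) (c j) * fischer (Q j) P := by
  induction P using MvPolynomial.induction_on' with
  | monomial α a =>
    simp only [fischer_monomial, coeff_sum, coeff_C_mul, map_sum, map_mul, Finset.mul_sum]
    exact Finset.sum_congr rfl fun j _ => by ring
  | add p q hp hq => simp only [map_add, hp, hq, mul_add, Finset.sum_add_distrib]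

lemma fischer_colForm_mul (M : Matrix n n ℂ) (i : n) (P Q : MvPolynomial n ℂ) :
    fischer Q (colForm M i * P) =
      fischer (∑ j, C ((starRingEnd ℂ) (M j i)) * pderiv j Q) P := by
  rw [fischer_sum_C_mul, colForm, Finset.sum_mul, map_sum]
  refine Finset.sum_congr rfl fun j _ => ?_
  rw [mul_assoc, ← smul_eq_C_mul, map_smul, fischer_X_mul, Complex.conj_conj, smul_eq_mul]

variable [DecidableEq n]

lemma pderiv_colForm (M : Matrix n n ℂ) (i j : n) : pderiv j (colForm M i) = C (M j i) := by
  simp [colForm, pderiv_X, Pi.single_apply]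

lemma sum_conj_mul_col (U : Matrix.unitaryGroup n ℂ) (i l : n) :
    ∑ j, (starRingEnd ℂ) (U.1 j i) * U.1 j l = if i = l then 1 else 0 := by
  have h := congrFun (congrFun (Matrix.UnitaryGroup.star_mul_self U) i) l
  rw [Matrix.mul_apply] at h
  simpa [Matrix.star_apply, Matrix.one_apply] using h

lemma sum_conj_mul_pderiv_colForm (U : Matrix.unitaryGroup n ℂ) (i l : n) :
    ∑ j, C ((starRingEnd ℂ) (U.1 j i)) * pderiv j (colForm U.1 l) =
      if i = l then 1 else 0 := by
  simp only [pderiv_colForm, ← C_mul, ← map_sum, sum_conj_mul_col]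
  split_ifs <;> simp

omit [DecidableEq n] in
lemma sum_C_mul_pderiv_mul (c : n → ℂ) (P Q : MvPolynomial n ℂ) :
    ∑ j, C (c j) * pderiv j (P * Q) =
      (∑ j, C (c j) * pderiv j P) * Q + P * ∑ j, C (c j) * pderiv j Q := by
  rw [Finset.sum_mul, Finset.mul_sum, ← Finset.sum_add_distrib]
  refine Finset.sum_congr rfl fun j _ => ?_
  rw [pderiv_mul]
  ring

lemma sum_conj_mul_pderiv_colProd (U : Matrix.unitaryGroup n ℂ) {S : Finset n} {i : n}
    (hi : i ∉ S) : ∑ j, C ((starRingEnd ℂ) (U.1 j i)) * pderiv j (colProd S U.1) = 0 := by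
  induction S using Finset.induction_on with
  | empty => simp [colProd]
  | insert l S hl ih =>
    rw [Finset.mem_insert, not_or] at hi
    have h : colProd (insert l S) U.1 = colForm U.1 l * colProd S U.1 :=
      Finset.prod_insert hl
    rw [h, sum_C_mul_pderiv_mul, ih hi.2, sum_conj_mul_pderiv_colForm, if_neg hi.1]
    simp

lemma fischer_colProd_self (U : Matrix.unitaryGroup n ℂ) (S : Finset n) :
    fischer (colProd S U.1) (colProd S U.1) = 1 := by
  induction S using Finset.induction_on with
  | empty =>
    have h : (1 : MvPolynomial n ℂ) = monomial 0 1 := rfl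
    simp only [colProd, Finset.prod_empty]
    nth_rw 2 [h]
    rw [fischer_monomial]
    simp [factorialProd]
  | insert i S hi ih =>
    have h : colProd (insert i S) U.1 = colForm U.1 i * colProd S U.1 :=
      Finset.prod_insert hi
    nth_rw 2 [h]
    rw [fischer_colForm_mul, h, sum_C_mul_pderiv_mul, sum_conj_mul_pderiv_colProd U hi,
      sum_conj_mul_pderiv_colForm, if_pos rfl, one_mul, mul_zero, add_zero, ih]

omit [DecidableEq n] in
lemma isHomogeneous_colProd (S : Finset n) (M : Matrix n n ℂ) :
    (colProd S M).IsHomogeneous S.card := by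
  have h := IsHomogeneous.prod S (colForm M) (fun _ => 1) fun i _ =>
    IsHomogeneous.sum _ _ _ fun j _ => by
      simpa using (isHomogeneous_C n (M j i)).mul (isHomogeneous_X ℂ j)
  simpa [colProd] using h

lemma mem_finsuppAntidiag_univ (α : n →₀ ℕ) (k : ℕ) :
    α ∈ Finset.univ.finsuppAntidiag k ↔ ∑ i, α i = k := by
  simp

lemma support_colProd_subset (S : Finset n) (M : Matrix n n ℂ) :
    (colProd S M).support ⊆ Finset.univ.finsuppAntidiag S.card := by
  intro α hα
  rw [mem_finsuppAntidiag_univ]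
  have h := isHomogeneous_colProd S M (mem_support_iff.mp hα)
  rw [← Finsupp.degree_eq_sum, Finsupp.degree_eq_weight_one]
  exact h

lemma sum_factorialProd_mul_coeff (U : Matrix.unitaryGroup n ℂ) (S : Finset n) :
    ∑ α ∈ Finset.univ.finsuppAntidiag S.card, (factorialProd α : ℂ) *
      ((colProd S U.1).coeff α * (starRingEnd ℂ) ((colProd S U.1).coeff α)) = 1 := by
  rw [← fischer_colProd_self U S]
  conv_rhs => enter [2]; rw [(colProd S U.1).as_sum]
  rw [map_sum, Finset.sum_subset (support_colProd_subset S U.1)]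
  · refine Finset.sum_congr rfl fun α _ => ?_
    rw [fischer_monomial]
    ring
  · intro α _ h
    rw [notMem_support_iff.mp h]
    simp

lemma eval_colProd (S : Finset n) (M : Matrix n n ℂ) (x : n → ℂ) :
    eval x (colProd S M) =
      ∑ α ∈ Finset.univ.finsuppAntidiag S.card, (colProd S M).coeff α * ∏ i, x i ^ α i := by
  rw [eval_eq', Finset.sum_subset (support_colProd_subset S M)]
  intro α _ h
  rw [notMem_support_iff.mp h, zero_mul]

omit [DecidableEq n] in
lemma eval_colProd_eq_prod (S : Finset n) (M : Matrix n n ℂ) (x : n → ℂ) :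
    eval x (colProd S M) = ∏ i ∈ S, ∑ j, M j i * x j := by
  simp [colProd, colForm]

end Fischer

/-- A bounded measurable complex-valued function. -/
def BddMeasurable {Ω : Type*} [MeasurableSpace Ω] (f : Ω → ℂ) : Prop :=
  Measurable f ∧ ∃ K : ℝ, ∀ ω, ‖f ω‖ ≤ K

namespace BddMeasurable

variable {Ω : Type*} [MeasurableSpace Ω] {f g : Ω → ℂ}

lemma const (c : ℂ) : BddMeasurable fun _ : Ω => c :=
  ⟨measurable_const, ‖c‖, fun _ => le_rfl⟩

lemma add (hf : BddMeasurable f) (hg : BddMeasurable g) :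
    BddMeasurable fun ω => f ω + g ω := by
  obtain ⟨hf, K, hK⟩ := hf
  obtain ⟨hg, L, hL⟩ := hg
  exact ⟨hf.add hg, K + L, fun ω => (norm_add_le _ _).trans (add_le_add (hK ω) (hL ω))⟩

lemma mul (hf : BddMeasurable f) (hg : BddMeasurable g) :
    BddMeasurable fun ω => f ω * g ω := by
  obtain ⟨hf, K, hK⟩ := hf
  obtain ⟨hg, L, hL⟩ := hg
  refine ⟨hf.mul hg, K * L, fun ω => ?_⟩
  rw [norm_mul]
  exact mul_le_mul (hK ω) (hL ω) (norm_nonneg _) ((norm_nonneg _).trans (hK ω))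

lemma conj (hf : BddMeasurable f) : BddMeasurable fun ω => (starRingEnd ℂ) (f ω) := by
  obtain ⟨hf, K, hK⟩ := hf
  exact ⟨Complex.continuous_conj.measurable.comp hf, K, fun ω => by
    rw [RCLike.norm_conj]; exact hK ω⟩

lemma sum {ι : Type*} {s : Finset ι} {F : ι → Ω → ℂ} (h : ∀ i ∈ s, BddMeasurable (F i)) :
    BddMeasurable fun ω => ∑ i ∈ s, F i ω := by
  classical
  induction s using Finset.induction_on with
  | empty => simpa using const 0
  | insert i s hi ih =>
    simp only [Finset.sum_insert hi]
    exact (h i (Finset.mem_insert_self i s)).add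
      (ih fun j hj => h j (Finset.mem_insert_of_mem hj))

lemma integrable (hf : BddMeasurable f) (μ : Measure Ω) [IsFiniteMeasure μ] :
    Integrable f μ := by
  obtain ⟨hf, K, hK⟩ := hf
  exact Integrable.of_bound hf.aestronglyMeasurable K (Filter.Eventually.of_forall hK)

lemma integral_sum {ι : Type*} {s : Finset ι} {F : ι → Ω → ℂ}
    (h : ∀ i ∈ s, BddMeasurable (F i)) (μ : Measure Ω) [IsFiniteMeasure μ] :
    ∫ ω, ∑ i ∈ s, F i ω ∂μ = ∑ i ∈ s, ∫ ω, F i ω ∂μ :=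
  MeasureTheory.integral_finsetSum s fun i hi => (h i hi).integrable μ

end BddMeasurable

section Haar

open MvPolynomial

variable {n : Type*} [Fintype n] [DecidableEq n]

lemma bddMeasurable_entry (i j : n) :
    BddMeasurable fun U : Matrix.unitaryGroup n ℂ => U.1 i j := by
  refine ⟨?_, 1, fun U => entry_norm_bound_of_unitary U.2 i j⟩
  exact (measurable_pi_apply j).comp ((measurable_pi_apply i).comp measurable_subtype_coe)

lemma bddMeasurable_coeff_colProd (S : Finset n) (α : n →₀ ℕ) :
    BddMeasurable fun U : Matrix.unitaryGroup n ℂ => (colProd S U.1).coeff α := by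
  induction S using Finset.induction_on generalizing α with
  | empty => simpa [colProd] using BddMeasurable.const _
  | insert i S hi ih =>
    simp only [colProd, Finset.prod_insert hi, coeff_mul]
    refine BddMeasurable.sum fun x _ => BddMeasurable.mul ?_ (ih x.2)
    simp only [colForm, coeff_sum, coeff_C_mul]
    exact BddMeasurable.sum fun j _ => (bddMeasurable_entry j i).mul (.const _)

lemma bddMeasurable_coeff_mul_conj (S T : Finset n) (α β : n →₀ ℕ) :
    BddMeasurable fun U : Matrix.unitaryGroup n ℂ =>
      (colProd S U.1).coeff α * (starRingEnd ℂ) ((colProd T U.1).coeff β) :=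
  (bddMeasurable_coeff_colProd S α).mul (bddMeasurable_coeff_colProd T β).conj

lemma measurable_unitary_mul_left (V : Matrix.unitaryGroup n ℂ) :
    Measurable fun U : Matrix.unitaryGroup n ℂ => V * U := by
  refine Measurable.subtype_mk ?_
  refine measurable_pi_iff.mpr fun i => measurable_pi_iff.mpr fun j => ?_
  simp only [Matrix.mul_apply]
  exact Finset.measurable_sum _ fun l _ => (bddMeasurable_entry l j).1.const_mul _

lemma integral_unitary_mul_left {μ : Measure (Matrix.unitaryGroup n ℂ)}
    (hinv : ∀ V : Matrix.unitaryGroup n ℂ, μ.map (fun U => V * U) = μ)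
    {f : Matrix.unitaryGroup n ℂ → ℂ} (hf : Measurable f) (V : Matrix.unitaryGroup n ℂ) :
    ∫ U, f (V * U) ∂μ = ∫ U, f U ∂μ := by
  conv_rhs => rw [← hinv V]
  exact (integral_map (measurable_unitary_mul_left V).aemeasurable
    hf.aestronglyMeasurable).symm

omit [DecidableEq n] in
lemma coeff_bind₁_C_mul_X (d : n → ℂ) (P : MvPolynomial n ℂ) (α : n →₀ ℕ) :
    (bind₁ (fun j => C (d j) * X j) P).coeff α = (∏ j, d j ^ α j) * P.coeff α := by
  induction P using MvPolynomial.induction_on' with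
  | monomial β c =>
    classical
    have h : bind₁ (fun j => C (d j) * X j) (monomial β c) =
        monomial β (c * ∏ j, d j ^ β j) := by
      rw [bind₁_monomial, Finset.prod_subset (Finset.subset_univ _), monomial_eq (s := β),
        Finsupp.prod_fintype _ _ (by simp), map_mul, map_prod, mul_assoc,
        ← Finset.prod_mul_distrib]
      · simp [mul_pow]
      · intro j _ hj
        rw [Finsupp.notMem_support_iff.mp hj, pow_zero]
    rw [h, coeff_monomial, coeff_monomial]
    split_ifs with h
    · rw [h, mul_comm]
    · simp
  | add p q hp hq => rw [map_add, coeff_add, coeff_add, hp, hq, mul_add]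

lemma colProd_diagonal_mul (S : Finset n) (d : n → ℂ) (M : Matrix n n ℂ) :
    colProd S (Matrix.diagonal d * M) = bind₁ (fun j => C (d j) * X j) (colProd S M) := by
  simp only [colProd, colForm, map_prod, map_sum, map_mul, Matrix.diagonal_mul, bind₁_X_right]
  refine Finset.prod_congr rfl fun i _ => Finset.sum_congr rfl fun j _ => ?_
  rw [bind₁_C_right]
  ring

lemma diagonal_mem_unitaryGroup {d : n → ℂ} (hd : ∀ i, d i * (starRingEnd ℂ) (d i) = 1) :
    Matrix.diagonal d ∈ Matrix.unitaryGroup n ℂ := by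
  rw [Matrix.mem_unitaryGroup_iff, Matrix.star_eq_conjTranspose, Matrix.diagonal_conjTranspose,
    Matrix.diagonal_mul_diagonal, ← Matrix.diagonal_one]
  exact congrArg _ (funext hd)

lemma exists_unit_pow_ne {p q : ℕ} (h : p ≠ q) :
    ∃ z : ℂ, z * (starRingEnd ℂ) z = 1 ∧ z ^ p * (starRingEnd ℂ) (z ^ q) ≠ 1 := by
  have hprim := Complex.isPrimitiveRoot_exp (p + q + 1) (by omega)
  set z := Complex.exp (2 * Real.pi * Complex.I / (p + q + 1 : ℕ))
  have hz : z * (starRingEnd ℂ) z = 1 := by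
    rw [Complex.mul_conj, Complex.normSq_eq_norm_sq, hprim.norm'_eq_one (by omega)]
    simp
  refine ⟨z, hz, fun h1 => h ?_⟩
  refine hprim.pow_inj (by omega) (by omega) ?_
  calc z ^ p = z ^ p * (z * (starRingEnd ℂ) z) ^ q := by rw [hz, one_pow, mul_one]
    _ = z ^ p * (starRingEnd ℂ) (z ^ q) * z ^ q := by rw [mul_pow, map_pow]; ring
    _ = z ^ q := by rw [h1, one_mul]

variable {μ : Measure (Matrix.unitaryGroup n ℂ)}

/-- Coefficients with different exponents are orthogonal under Haar measure. -/
lemma integral_coeff_mul_conj_of_ne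
    (hinv : ∀ V : Matrix.unitaryGroup n ℂ, μ.map (fun U => V * U) = μ)
    (S T : Finset n) {α β : n →₀ ℕ} (h : α ≠ β) :
    ∫ U, (colProd S U.1).coeff α * (starRingEnd ℂ) ((colProd T U.1).coeff β) ∂μ = 0 := by
  obtain ⟨i, hi⟩ := DFunLike.ne_iff.mp h
  obtain ⟨z, hz, hne⟩ := exists_unit_pow_ne hi
  have hd : ∀ j, Pi.mulSingle (M := fun _ : n => ℂ) i z j *
      (starRingEnd ℂ) (Pi.mulSingle (M := fun _ : n => ℂ) i z j) = 1 := by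
    intro j
    rcases eq_or_ne j i with rfl | hj
    · simpa using hz
    · simp [Pi.mulSingle_eq_of_ne hj]
  have hpow (γ : n →₀ ℕ) :
      ∏ j, Pi.mulSingle (M := fun _ : n => ℂ) i z j ^ γ j = z ^ γ i := by
    rw [Finset.prod_eq_single i]
    · simp
    · intro j _ hj
      simp [Pi.mulSingle_eq_of_ne hj]
    · simp
  have key := integral_unitary_mul_left hinv (bddMeasurable_coeff_mul_conj S T α β).1
    ⟨_, diagonal_mem_unitaryGroup hd⟩
  simp only [Matrix.UnitaryGroup.mul_val, colProd_diagonal_mul, coeff_bind₁_C_mul_X, hpow] at key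
  have hscale : ∀ x y : ℂ, z ^ α i * x * (starRingEnd ℂ) (z ^ β i * y) =
      z ^ α i * (starRingEnd ℂ) (z ^ β i) * (x * (starRingEnd ℂ) y) := by
    intro x y
    rw [map_mul]
    ring
  simp only [hscale] at key
  rw [integral_const_mul] at key
  by_contra h0
  exact hne (mul_right_cancel₀ h0 (key.trans (one_mul _).symm))

lemma exists_unitary_row_eq (i₀ : n) (x : EuclideanSpace ℂ n) :
    ∃ V : Matrix.unitaryGroup n ℂ, ∀ j, x j = (‖x‖ : ℂ) * V.1 i₀ j := by
  rcases eq_or_ne x 0 with rfl | hx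
  · exact ⟨1, by simp⟩
  have hnorm : (‖x‖ : ℂ) ≠ 0 := by simpa using hx
  have hv : Orthonormal ℂ
      (({i₀} : Set n).domRestrict fun _ : n => ((‖x‖ : ℂ)⁻¹ • x : EuclideanSpace ℂ n)) := by
    constructor
    · intro _
      simp [norm_smul, hx]
    · intro a b hab
      exact absurd (Subsingleton.elim a b) hab
  obtain ⟨b, hb⟩ := hv.exists_orthonormalBasis_extension_of_card_eq (by simp)
  have hb0 := hb i₀ rfl
  refine ⟨⟨Matrix.of fun i j => b i j, ?_⟩, fun j => ?_⟩
  · rw [Matrix.mem_unitaryGroup_iff]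
    ext i k
    have h := orthonormal_iff_ite.mp b.orthonormal k i
    rw [PiLp.inner_apply] at h
    simp only [RCLike.inner_apply] at h
    simp only [Matrix.mul_apply, Matrix.star_apply, Matrix.of_apply, Matrix.one_apply]
    simpa [eq_comm] using h
  · simp [hb0, hnorm]

omit [DecidableEq n] in
lemma eval_colProd_mul (S : Finset n) (V M : Matrix n n ℂ) (x : n → ℂ) :
    eval x (colProd S (V * M)) = eval (fun l => ∑ j, V j l * x j) (colProd S M) := by
  rw [eval_colProd_eq_prod, eval_colProd_eq_prod]
  refine Finset.prod_congr rfl fun i _ => ?_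
  simp only [Matrix.mul_apply, Finset.sum_mul, Finset.mul_sum]
  rw [Finset.sum_comm]
  exact Finset.sum_congr rfl fun l _ => Finset.sum_congr rfl fun j _ => by ring

lemma bddMeasurable_eval_colProd (S : Finset n) (x : n → ℂ) :
    BddMeasurable fun U : Matrix.unitaryGroup n ℂ => eval x (colProd S U.1) := by
  simp only [eval_colProd]
  exact .sum fun α _ => (bddMeasurable_coeff_colProd S α).mul (.const _)

/-- The mean square of `colProd S` at `x` depends on `x` only through its norm. -/
lemma exists_integral_eval_colProd_eq [Nonempty n]
    (hinv : ∀ V : Matrix.unitaryGroup n ℂ, μ.map (fun U => V * U) = μ) (S : Finset n) :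
    ∃ c : ℂ, ∀ x : n → ℂ,
      ∫ U, eval x (colProd S U.1) * (starRingEnd ℂ) (eval x (colProd S U.1)) ∂μ =
        c * (∑ i, x i * (starRingEnd ℂ) (x i)) ^ S.card := by
  obtain ⟨i₀⟩ := ‹Nonempty n›
  refine ⟨∫ U, (∏ i ∈ S, U.1 i₀ i) * (starRingEnd ℂ) (∏ i ∈ S, U.1 i₀ i) ∂μ, fun x => ?_⟩
  obtain ⟨V, hV⟩ := exists_unitary_row_eq i₀ (WithLp.toLp 2 x)
  set r : ℝ := ‖(WithLp.toLp 2 x : EuclideanSpace ℂ n)‖ with hr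
  have hr2 : ∑ i, x i * (starRingEnd ℂ) (x i) = (r : ℂ) ^ 2 := by
    rw [← Complex.ofReal_pow, hr, EuclideanSpace.norm_sq_eq]
    simp [Complex.mul_conj, Complex.normSq_eq_norm_sq]
  have hx : x = fun l => ∑ j, V.1 j l * (Pi.single i₀ (r : ℂ) : n → ℂ) j := by
    funext l
    simpa [Pi.single_apply, mul_comm] using hV l
  have hm := (bddMeasurable_eval_colProd S (Pi.single i₀ (r : ℂ))).mul
    (bddMeasurable_eval_colProd S (Pi.single i₀ (r : ℂ))).conj
  have key := integral_unitary_mul_left hinv hm.1 V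
  simp only [Matrix.UnitaryGroup.mul_val, eval_colProd_mul, ← hx] at key
  rw [key, hr2, mul_comm, ← integral_const_mul]
  refine integral_congr_ae (Filter.Eventually.of_forall fun U => ?_)
  simp [eval_colProd_eq_prod, Pi.single_apply, Finset.prod_mul_distrib]
  ring

lemma integral_eval_colProd_eq_sum [IsProbabilityMeasure μ]
    (hinv : ∀ V : Matrix.unitaryGroup n ℂ, μ.map (fun U => V * U) = μ)
    (S : Finset n) (x : n → ℂ) :
    ∫ U, eval x (colProd S U.1) * (starRingEnd ℂ) (eval x (colProd S U.1)) ∂μ =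
      ∑ α ∈ Finset.univ.finsuppAntidiag S.card,
        (∫ U, (colProd S U.1).coeff α * (starRingEnd ℂ) ((colProd S U.1).coeff α) ∂μ) *
          ∏ i, (x i * (starRingEnd ℂ) (x i)) ^ α i := by
  have hexp : ∀ U : Matrix.unitaryGroup n ℂ,
      eval x (colProd S U.1) * (starRingEnd ℂ) (eval x (colProd S U.1)) =
      ∑ α ∈ Finset.univ.finsuppAntidiag S.card, ∑ β ∈ Finset.univ.finsuppAntidiag S.card,
        (colProd S U.1).coeff α * (starRingEnd ℂ) ((colProd S U.1).coeff β) *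
          ((∏ i, x i ^ α i) * (starRingEnd ℂ) (∏ i, x i ^ β i)) := by
    intro U
    rw [eval_colProd, map_sum, Finset.sum_mul_sum]
    refine Finset.sum_congr rfl fun α _ => Finset.sum_congr rfl fun β _ => ?_
    rw [map_mul]
    ring
  have hb (α β : n →₀ ℕ) : BddMeasurable fun U : Matrix.unitaryGroup n ℂ =>
      (colProd S U.1).coeff α * (starRingEnd ℂ) ((colProd S U.1).coeff β) *
          ((∏ i, x i ^ α i) * (starRingEnd ℂ) (∏ i, x i ^ β i)) :=
    (bddMeasurable_coeff_mul_conj S S α β).mul (.const _)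
  simp only [hexp]
  rw [BddMeasurable.integral_sum fun α _ => .sum fun β _ => hb α β]
  refine Finset.sum_congr rfl fun α hα => ?_
  rw [BddMeasurable.integral_sum fun β _ => hb α β, Finset.sum_eq_single_of_mem α hα]
  · rw [integral_mul_const]
    simp [mul_pow, Finset.prod_mul_distrib]
  · intro β _ hβ
    rw [integral_mul_const, integral_coeff_mul_conj_of_ne hinv S S hβ.symm, zero_mul]

/-- Up to a common factor, the mean square of a coefficient is the multinomial coefficient. -/
lemma exists_integral_coeff_eq [Nonempty n] [IsProbabilityMeasure μ]
    (hinv : ∀ V : Matrix.unitaryGroup n ℂ, μ.map (fun U => V * U) = μ) (S : Finset n) :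
    ∃ c : ℂ, ∀ α ∈ Finset.univ.finsuppAntidiag S.card, (factorialProd α : ℂ) *
      ∫ U, (colProd S U.1).coeff α * (starRingEnd ℂ) ((colProd S U.1).coeff α) ∂μ = c := by
  obtain ⟨c, hc⟩ := exists_integral_eval_colProd_eq hinv S
  refine ⟨c * (S.card.factorial : ℂ), fun α hα => ?_⟩
  set A : (n →₀ ℕ) → ℂ := fun α =>
    ∫ U, (colProd S U.1).coeff α * (starRingEnd ℂ) ((colProd S U.1).coeff α) ∂μ with hA
  have hpoly : (∑ β ∈ Finset.univ.finsuppAntidiag S.card, monomial β (A β)) =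
      C c * (∑ i, X i : MvPolynomial n ℂ) ^ S.card := by
    refine funext_set (fun _ => Set.range fun r : ℝ => (r : ℂ) * (starRingEnd ℂ) (r : ℂ))
      (fun _ => ?_) fun t ht => ?_
    · refine Set.infinite_of_injective_forall_mem (f := fun m : ℕ => ((m ^ 2 : ℕ) : ℂ)) ?_ ?_
      · intro p q hpq
        exact Nat.pow_left_injective two_ne_zero (Nat.cast_injective hpq)
      · intro m
        exact ⟨m, by simp [sq]⟩
    · choose r hr using fun i => ht i (Set.mem_univ i)
      have h := (integral_eval_colProd_eq_sum hinv S fun i => (r i : ℂ)).symm.trans (hc _)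
      simp only [hr] at h
      simpa [eval_monomial, Finsupp.prod_fintype] using h
  have hcoeff := congrArg (coeff α) hpoly
  have hsum := (mem_finsuppAntidiag_univ α S.card).mp hα
  rw [coeff_C_mul, coeff_sum_X_pow_of_fintype, if_pos (by rwa [Finsupp.sum_fintype _ _ (by simp)]),
    coeff_sum] at hcoeff
  simp only [coeff_monomial, Finset.sum_ite_eq', if_pos hα] at hcoeff
  change _ * A α = _
  rw [hcoeff, ← hsum, ← Nat.multinomial_spec,
    Finsupp.multinomial_eq_of_support_subset (Finset.subset_univ _)]
  unfold factorialProd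
  push_cast
  ring

/-- The mean square of a permanental minor of a Haar unitary matrix. -/
lemma integral_coeff_indicatorExp_self [Nonempty n] [IsProbabilityMeasure μ]
    (hinv : ∀ V : Matrix.unitaryGroup n ℂ, μ.map (fun U => V * U) = μ) (S : Finset n) :
    ∫ U, (colProd S U.1).coeff (indicatorExp S) *
      (starRingEnd ℂ) ((colProd S U.1).coeff (indicatorExp S)) ∂μ =
      ((Fintype.card n + S.card - 1).choose S.card : ℂ)⁻¹ := by
  obtain ⟨c, hc⟩ := exists_integral_coeff_eq hinv S
  have hS := hc _ ((mem_finsuppAntidiag_univ (indicatorExp S) _).mpr (sum_indicatorExp S))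
  rw [factorialProd_indicatorExp, Nat.cast_one, one_mul] at hS
  have h1 : ∫ U, ∑ α ∈ Finset.univ.finsuppAntidiag S.card, (factorialProd α : ℂ) *
      ((colProd S U.1).coeff α * (starRingEnd ℂ) ((colProd S U.1).coeff α)) ∂μ = 1 := by
    simp only [sum_factorialProd_mul_coeff]
    simp
  rw [BddMeasurable.integral_sum fun α _ =>
    (BddMeasurable.const _).mul (bddMeasurable_coeff_mul_conj S S α α)] at h1
  simp only [integral_const_mul] at h1
  rw [Finset.sum_congr rfl hc, Finset.sum_const, Finset.card_finsuppAntidiag_nat_eq_choose,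
    nsmul_eq_mul, Finset.card_univ] at h1
  rw [hS]
  exact eq_inv_of_mul_eq_one_right h1

end Haar

section Permanent

open MvPolynomial

variable {n : Type*} [Fintype n] [DecidableEq n]

/-- The permanent is the squarefree coefficient of the product of all column forms. -/
lemma perm_eq_coeff_colProd (M : Matrix n n ℂ) :
    perm M = (colProd Finset.univ M).coeff (indicatorExp Finset.univ) := by
  have hexp : colProd Finset.univ M =
      ∑ f : n → n, monomial (∑ i, Finsupp.single (f i) 1) (∏ i, M (f i) i) := by
    simp only [colProd, colForm]
    rw [Fintype.prod_sum]
    refine Finset.sum_congr rfl fun f _ => ?_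
    simp only [C_mul_X_eq_monomial]
    exact (monomial_sum_prod _ _ _).symm
  rw [hexp, coeff_sum, perm]
  refine Finset.sum_of_injOn (fun σ : Equiv.Perm n => (⇑σ⁻¹ : n → n)) ?_ (by simp) ?_ ?_
  · exact fun σ _ τ _ h => inv_injective (DFunLike.coe_injective h)
  · intro f _ hf
    rw [coeff_monomial, if_neg]
    intro h
    apply hf
    have hsurj : Function.Surjective f := by
      intro j
      by_contra! hj
      have h1 := DFunLike.congr_fun h j
      rw [indicatorExp_apply, Finsupp.finsetSum_apply] at h1
      simp [hj] at h1
    have hbij : Function.Bijective f := ⟨Finite.injective_iff_surjective.mpr hsurj, hsurj⟩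
    exact ⟨(Equiv.ofBijective f hbij)⁻¹, by simp, by simp⟩
  · intro σ _
    rw [coeff_monomial, if_pos]
    · rw [← Equiv.prod_comp σ fun i => M (σ⁻¹ i) i]
      simp
    · exact Equiv.sum_comp σ⁻¹ fun i => Finsupp.single i 1

lemma colForm_smul_one_sub (a : ℂ) (M : Matrix n n ℂ) (i : n) :
    colForm (a • (1 : Matrix n n ℂ) - M) i = C a * X i - colForm M i := by
  simp [colForm, Matrix.one_apply, sub_mul, Finset.sum_sub_distrib, apply_ite, ite_mul]

/-- Expansion of the permanental polynomial in principal permanental minors. -/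
lemma perm_smul_one_sub (a : ℂ) (M : Matrix n n ℂ) :
    perm (a • (1 : Matrix n n ℂ) - M) = ∑ S ∈ Finset.univ.powerset,
      (-1) ^ S.card * a ^ (Fintype.card n - S.card) *
        (colProd S M).coeff (indicatorExp S) := by
  rw [perm_eq_coeff_colProd, colProd]
  simp only [colForm_smul_one_sub]
  rw [Finset.prod_sub, coeff_sum]
  refine Finset.sum_congr rfl fun S _ => ?_
  have hmon : ∏ i ∈ Finset.univ \ S, (C a * X i : MvPolynomial n ℂ) =
      monomial (indicatorExp (Finset.univ \ S)) (a ^ (Fintype.card n - S.card)) := by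
    simp only [C_mul_X_eq_monomial]
    rw [← Finset.card_univ, ← Finset.card_sdiff_of_subset (Finset.subset_univ S),
      ← Finset.prod_const]
    exact (monomial_sum_prod _ _ _).symm
  have hind : indicatorExp (Finset.univ : Finset n) =
      indicatorExp (Finset.univ \ S) + indicatorExp S :=
    (Finset.sum_sdiff (Finset.subset_univ S)).symm
  have hsign : ((-1) ^ S.card : MvPolynomial n ℂ) = C ((-1) ^ S.card) := by simp
  rw [hmon, hind, mul_assoc, hsign, coeff_C_mul, coeff_monomial_mul, mul_assoc]
  rfl

lemma choose_mul_inv_choose {N m : ℕ} (hN : 1 ≤ N) (hm : m ≤ N) :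
    (N.choose m : ℂ) * ((N + m - 1).choose m : ℂ)⁻¹ =
      (N.factorial : ℂ) * ((N - 1).factorial : ℂ) /
        (((N - m).factorial : ℂ) * ((2 * N - 1 - (N - m)).factorial : ℂ)) := by
  have h1 : N + m - 1 = (N - 1) + m := by omega
  have h2 : 2 * N - 1 - (N - m) = (N - 1) + m := by omega
  have hf (k : ℕ) : (k.factorial : ℂ) ≠ 0 := Nat.cast_ne_zero.mpr k.factorial_ne_zero
  rw [h1, h2, Nat.cast_choose ℂ hm, Nat.cast_choose ℂ (Nat.le_add_left m (N - 1)),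
    Nat.add_sub_cancel]
  have := hf m
  have := hf N
  have := hf (N - 1)
  have := hf (N - m)
  have := hf (N - 1 + m)
  field_simp

/-- Two-point correlations of permanental polynomials as a sum over principal minors. -/
lemma integral_perm_mul_conj_perm [Nonempty n] (a b : ℂ)
    (μ : Measure (Matrix.unitaryGroup n ℂ)) [IsProbabilityMeasure μ]
    (hinv : ∀ V : Matrix.unitaryGroup n ℂ, μ.map (fun U => V * U) = μ) :
    ∫ U, perm (a • (1 : Matrix n n ℂ) - U.1) *
        (starRingEnd ℂ) (perm (b • (1 : Matrix n n ℂ) - U.1)) ∂μ =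
      ∑ S ∈ (Finset.univ : Finset n).powerset,
        (a * (starRingEnd ℂ) b) ^ (Fintype.card n - S.card) *
          ((Fintype.card n + S.card - 1).choose S.card : ℂ)⁻¹ := by
  have hexp : ∀ U : Matrix.unitaryGroup n ℂ, perm (a • (1 : Matrix n n ℂ) - U.1) *
      (starRingEnd ℂ) (perm (b • (1 : Matrix n n ℂ) - U.1)) =
      ∑ S ∈ (Finset.univ : Finset n).powerset, ∑ T ∈ (Finset.univ : Finset n).powerset,
        ((-1) ^ S.card * a ^ (Fintype.card n - S.card) *
          (starRingEnd ℂ) ((-1) ^ T.card * b ^ (Fintype.card n - T.card))) *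
        ((colProd S U.1).coeff (indicatorExp S) *
          (starRingEnd ℂ) ((colProd T U.1).coeff (indicatorExp T))) := by
    intro U
    rw [perm_smul_one_sub, perm_smul_one_sub, map_sum, Finset.sum_mul_sum]
    refine Finset.sum_congr rfl fun S _ => Finset.sum_congr rfl fun T _ => ?_
    rw [map_mul]
    ring
  have hb (S T : Finset n) : BddMeasurable fun U : Matrix.unitaryGroup n ℂ =>
      ((-1) ^ S.card * a ^ (Fintype.card n - S.card) *
          (starRingEnd ℂ) ((-1) ^ T.card * b ^ (Fintype.card n - T.card))) *
        ((colProd S U.1).coeff (indicatorExp S) *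
          (starRingEnd ℂ) ((colProd T U.1).coeff (indicatorExp T))) :=
    (BddMeasurable.const _).mul (bddMeasurable_coeff_mul_conj _ _ _ _)
  simp only [hexp]
  rw [BddMeasurable.integral_sum fun S _ => .sum fun T _ => hb S T]
  refine Finset.sum_congr rfl fun S hS => ?_
  rw [BddMeasurable.integral_sum fun T _ => hb S T, Finset.sum_eq_single_of_mem S hS]
  · rw [integral_const_mul, integral_coeff_indicatorExp_self hinv]
    congr 1
    have hsign : ((-1 : ℂ) ^ S.card) * (-1) ^ S.card = 1 := by
      rw [← mul_pow]
      simp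
    rw [map_mul, map_pow, map_pow, map_neg, map_one, mul_pow, mul_mul_mul_comm, hsign, one_mul]
  · intro T _ hT
    have hne : indicatorExp S ≠ indicatorExp T := by
      refine fun h => hT (Finset.ext fun i => ?_)
      have hi := DFunLike.congr_fun h i
      rw [indicatorExp_apply, indicatorExp_apply] at hi
      by_cases h1 : i ∈ S <;> by_cases h2 : i ∈ T <;> simp_all
    rw [integral_const_mul, integral_coeff_mul_conj_of_ne hinv S T hne, mul_zero]

end Permanent

/-- Two-point correlation function of CUE permanental polynomials: for the Haar
probability measure on `U(N)`,
`∫ Per(a·1-U) conj(Per(b·1-U)) dμ_N(U) = N!(N-1)! Σ_{j=0}^N (a b̄)^j / (j!(2N-1-j)!)`. -/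
theorem cue_two_point_correlation (N : ℕ) (hN : 1 ≤ N) (a b : ℂ)
    (μH : Measure (Matrix.unitaryGroup (Fin N) ℂ)) [IsProbabilityMeasure μH]
    (hinv : ∀ V : Matrix.unitaryGroup (Fin N) ℂ, μH.map (fun U => V * U) = μH) :
    (∫ U : Matrix.unitaryGroup (Fin N) ℂ,
        perm (a • (1 : Matrix (Fin N) (Fin N) ℂ) - (U : Matrix (Fin N) (Fin N) ℂ)) *
        (starRingEnd ℂ)
          (perm (b • (1 : Matrix (Fin N) (Fin N) ℂ) - (U : Matrix (Fin N) (Fin N) ℂ))) ∂μH)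
      = (N.factorial : ℂ) * ((N - 1).factorial : ℂ) *
          ∑ j ∈ Finset.range (N + 1),
            (a * (starRingEnd ℂ) b) ^ j /
              ((j.factorial : ℂ) * (((2 * N - 1 - j).factorial : ℂ))) := by
  have : Nonempty (Fin N) := ⟨⟨0, hN⟩⟩
  rw [integral_perm_mul_conj_perm a b μH hinv, Fintype.card_fin,
    Finset.sum_powerset_apply_card fun m =>
      (a * (starRingEnd ℂ) b) ^ (N - m) * ((N + m - 1).choose m : ℂ)⁻¹,
    Finset.card_univ, Fintype.card_fin, Finset.mul_sum, ← Finset.sum_range_reflect]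
  refine Finset.sum_congr rfl fun j hj => ?_
  have hj' : j ≤ N := Nat.lt_succ_iff.mp (Finset.mem_range.mp hj)
  have h := choose_mul_inv_choose hN (Nat.sub_le N j)
  rw [Nat.sub_sub_self hj'] at h
  rw [show N + 1 - 1 - j = N - j by omega, Nat.sub_sub_self hj', nsmul_eq_mul, mul_left_comm, h]
  ring
end
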